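/- For every n ≥ 1, the map Ω ↦ (u(Ω), v(Ω)) from RTSeq_n to S_n × S_n is injective, and its image is exactly the set of pairs (u, v) ∈ S_n × S_n such that ℓ_a(v) − ℓ_a(u) ∈ {0, 1} for all 1 ≤ a ≤ n. -/

import Mathlib

/-!
Statement 11.  For `n ≥ 1`, the map `Ω ↦ (u(Ω), v(Ω))` from `RTSeq_n` to `S_n × S_n` is
injective, and its image is exactly the set of pairs `(u, v) ∈ S_n × S_n` with
`ℓ_a(v) − ℓ_a(u) ∈ {0, 1}` for all `1 ≤ a ≤ n` (0-indexed: all `a < n`).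
-/

/-- Permutations of the positive integers are modelled by `Equiv.Perm ℕ`, the positive
integer `p` corresponding to `p − 1 : ℕ`.  The insertion map `ins_i` (here `ins (i-1)`,
`0`-indexed) sends `j ↦ w(j) + 1` for `j < i`, `i ↦ 0`, and `j ↦ w(j−1) + 1` for `j > i`. -/
def ins (i : ℕ) (w : Equiv.Perm ℕ) : Equiv.Perm ℕ where
  toFun j := if j < i then w j + 1 else if j = i then 0 else w (j - 1) + 1
  invFun b := if b = 0 then i else if w.symm (b - 1) < i then w.symm (b - 1) else w.symm (b - 1) + 1
  left_inv := by
    intro j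
    dsimp only
    by_cases h1 : j < i
    · rw [if_pos h1, if_neg (by omega : ¬ (w j + 1 = 0)), Nat.add_sub_cancel,
        Equiv.symm_apply_apply, if_pos h1]
    · by_cases h2 : j = i
      · rw [if_neg h1, if_pos h2, if_pos rfl, h2]
      · rw [if_neg h1, if_neg h2, if_neg (by omega : ¬ (w (j - 1) + 1 = 0)),
          Nat.add_sub_cancel, Equiv.symm_apply_apply,
          if_neg (by omega : ¬ (j - 1 < i)), Nat.sub_add_cancel (by omega)]
  right_inv := by
    intro b
    dsimp only
    by_cases hb : b = 0
    · rw [if_pos hb, if_neg (lt_irrefl i), if_pos rfl, hb]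
    · rw [if_neg hb]
      by_cases hc : w.symm (b - 1) < i
      · rw [if_pos hc, if_pos hc, Equiv.apply_symm_apply, Nat.sub_add_cancel (by omega)]
      · rw [if_neg hc, if_neg (by omega : ¬ (w.symm (b - 1) + 1 < i)),
          if_neg (by omega : ¬ (w.symm (b - 1) + 1 = i)), Nat.add_sub_cancel,
          Equiv.apply_symm_apply, Nat.sub_add_cancel (by omega)]

/-- The number `ℓ(u)` of inversions of `u`. -/
noncomputable def invCount (u : Equiv.Perm ℕ) : ℕ :=
  Set.ncard {p : ℕ × ℕ | p.1 < p.2 ∧ u p.2 < u p.1}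

/-- The Bruhat order: `u ≤ v` iff there is a chain `u = w₀, …, w_m = v` where each
`w_{s+1} = w_s · τ_s` for a transposition `τ_s`, with `ℓ(w_{s+1}) > ℓ(w_s)`. -/
noncomputable def bruhatLE (u v : Equiv.Perm ℕ) : Prop :=
  ∃ (m : ℕ) (c : ℕ → Equiv.Perm ℕ), c 0 = u ∧ c m = v ∧
    ∀ s < m, (∃ a b : ℕ, a ≠ b ∧ c (s + 1) = c s * Equiv.swap a b) ∧
      invCount (c s) < invCount (c (s + 1))

/-- `ℓ_a(u) = #{b ≥ a : u⁻¹(b) ≤ u⁻¹(a)}` (0-indexed: this is `ℓ_{a+1}` of the paper). -/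
noncomputable def lA (a : ℕ) (u : Equiv.Perm ℕ) : ℕ :=
  Set.ncard {b : ℕ | a ≤ b ∧ u.symm b ≤ u.symm a}

/-- `u` fixes all but finitely many points, i.e. `u ∈ S_∞`. -/
def finitary (u : Equiv.Perm ℕ) : Prop := {a : ℕ | u a ≠ a}.Finite

/-- `u ∈ S_n`: `u` fixes every point `j > n` (0-indexed: every `j ≥ n`). -/
def inSn (n : ℕ) (u : Equiv.Perm ℕ) : Prop := ∀ j, n ≤ j → u j = j

/-- The formal letters `r_j, t_j` (`j ≥ 1`); here `RTLetter.r k` stands for `r_{k+1}`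
and `RTLetter.t k` for `t_{k+1}`. -/
inductive RTLetter : Type
  | r : ℕ → RTLetter
  | t : ℕ → RTLetter
deriving DecidableEq

/-- One step of the recursion defining `(u(Ω), v(Ω))`:
`r_j` maps `(u,v) ↦ (ins_j u, ins_j v)` and `t_j` maps `(u,v) ↦ (ins_j u, ins_{j+1} v)`. -/
def stepRT (p : Equiv.Perm ℕ × Equiv.Perm ℕ) : RTLetter → Equiv.Perm ℕ × Equiv.Perm ℕ
  | .r k => (ins k p.1, ins k p.2)
  | .t k => (ins k p.1, ins (k + 1) p.2)

/-- The pair `(u(Ω), v(Ω))` attached to a sequence `Ω` (a list of letters, first letter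
first):  `u(∅) = v(∅) = id`, and the last letter is applied outermost. -/
def uv (L : List RTLetter) : Equiv.Perm ℕ × Equiv.Perm ℕ := L.foldl stepRT (1, 1)

/-- The letter at (0-indexed) position `p` of a sequence in `RTSeq_n` must lie in
`{r₁, t₁, …, r_{p}, t_{p}, r_{p+1}}` (1-indexed position `s = p+1`). -/
def validLetter (p : ℕ) : RTLetter → Prop
  | .r k => k ≤ p
  | .t k => k + 1 ≤ p

/-- `Ω ∈ RTSeq_n`: a sequence of `n` letters `X₁⋯X_n` with
`X_s ∈ {r₁, t₁, …, r_{s−1}, t_{s−1}, r_s}`. -/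
def validSeq (n : ℕ) (L : List RTLetter) : Prop :=
  L.length = n ∧ ∀ p < L.length, validLetter p (L.getD p (.r 0))

/-- `|Ω|_t`, the number of letters of the form `t_j`. -/
def countT (L : List RTLetter) : ℕ :=
  L.countP (fun X => match X with | .t _ => true | .r _ => false)

/-- `c_n`, the backwards long cycle `n 1 2 ⋯ (n−1)` (0-indexed on `ℕ`:
`0 ↦ n−1`, `j ↦ j−1` for `1 ≤ j ≤ n−1`, `j ↦ j` for `j ≥ n`). -/
def cB (n : ℕ) : Equiv.Perm ℕ where
  toFun j := if j = 0 then n - 1 else if j ≤ n - 1 then j - 1 else j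
  invFun j := if j = n - 1 then 0 else if j < n - 1 then j + 1 else j
  left_inv := by
    intro j
    dsimp only
    split_ifs <;> (try exact absurd rfl ‹_›) <;> (try exact (‹False›).elim) <;> omega
  right_inv := by
    intro j
    dsimp only
    split_ifs <;> (try exact absurd rfl ‹_›) <;> (try exact (‹False›).elim) <;> omega

/-- `Ω′` is obtained from `Ω` by replacing the letters `t_i` at some subset of the
positions by either `r_i` or `r_{i+1}`. -/
def isReplacement (L L' : List RTLetter) : Prop :=
  L'.length = L.length ∧
  ∀ p < L.length,
    L'.getD p (.r 0) = L.getD p (.r 0) ∨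
    ∃ k, L.getD p (.r 0) = .t k ∧ (L'.getD p (.r 0) = .r k ∨ L'.getD p (.r 0) = .r (k + 1))


theorem ins_apply (i : ℕ) (w : Equiv.Perm ℕ) (j : ℕ) :
    ins i w j = if j < i then w j + 1 else if j = i then 0 else w (j - 1) + 1 := rfl

theorem ins_symm_apply (i : ℕ) (w : Equiv.Perm ℕ) (b : ℕ) :
    (ins i w).symm b =
      if b = 0 then i else if w.symm (b - 1) < i then w.symm (b - 1) else w.symm (b - 1) + 1 := rfl

theorem ins_symm_zero (i : ℕ) (w : Equiv.Perm ℕ) : (ins i w).symm 0 = i := rfl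

theorem ins_inj {i j : ℕ} {w x : Equiv.Perm ℕ} : ins i w = ins j x ↔ i = j ∧ w = x := by
  refine ⟨fun h => ?_, fun ⟨h, h'⟩ => by rw [h, h']⟩
  obtain rfl : i = j := by simpa [ins_symm_zero] using congrArg (fun u => u.symm 0) h
  refine ⟨rfl, Equiv.ext fun k => ?_⟩
  by_cases hk : k < i
  · have := congrArg (fun u => u k) h
    simpa [ins_apply, hk] using this
  · have := congrArg (fun u => u (k + 1)) h
    simpa [ins_apply, show ¬ k + 1 < i by omega, show k + 1 ≠ i by omega] using this

theorem lA_zero (u : Equiv.Perm ℕ) : lA 0 u = u.symm 0 + 1 := by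
  have : {b : ℕ | 0 ≤ b ∧ u.symm b ≤ u.symm 0} = u '' Set.Iic (u.symm 0) := by
    ext b
    simp [Equiv.image_eq_preimage_symm]
  rw [lA, this, Set.ncard_image_of_injective _ u.injective, ← Finset.coe_Iic,
    Set.ncard_coe_finset, Nat.card_Iic]

theorem lA_succ_ins (a i : ℕ) (w : Equiv.Perm ℕ) : lA (a + 1) (ins i w) = lA a w := by
  have : {b : ℕ | a + 1 ≤ b ∧ (ins i w).symm b ≤ (ins i w).symm (a + 1)} =
      Nat.succ '' {b : ℕ | a ≤ b ∧ w.symm b ≤ w.symm a} := by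
    ext b
    cases b with
    | zero => simp
    | succ b =>
      simp only [ins_symm_apply, Set.mem_ofPred_eq, Set.mem_image, Nat.succ_eq_add_one,
        Nat.add_right_cancel_iff, exists_eq_right, Nat.add_sub_cancel, Nat.add_one_ne_zero,
        if_false, Nat.add_le_add_iff_right]
      split_ifs <;> omega
  rw [lA, this, Set.ncard_image_of_injective _ Nat.succ_injective, lA]

theorem inSn_ins {n i : ℕ} {w : Equiv.Perm ℕ} (hi : i ≤ n) (hw : inSn n w) :
    inSn (n + 1) (ins i w) := by
  intro j hj
  rw [ins_apply, if_neg (by omega), if_neg (by omega), hw (j - 1) (by omega)]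
  omega

theorem exists_ins_eq (u : Equiv.Perm ℕ) : ∃ w, ins (u.symm 0) w = u := by
  set i := u.symm 0 with hi
  have hui : u i = 0 := by simp [hi]
  have hu0 : ∀ j, u j = 0 ↔ j = i := fun j => by rw [← hui, u.apply_eq_iff_eq]
  let d : ℕ → ℕ := fun j => if j < i then j else j + 1
  have hd : ∀ j, d j ≠ i := fun j => by simp only [d]; split_ifs <;> omega
  have hd_inj : Function.Injective d := fun j k h => by
    simp only [d] at h
    split_ifs at h <;> omega
  have hpos : ∀ j, u (d j) - 1 + 1 = u (d j) := fun j =>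
    Nat.sub_add_cancel (Nat.one_le_iff_ne_zero.2 (mt (hu0 _).1 (hd j)))
  have hbij : Function.Bijective fun j => u (d j) - 1 := by
    refine ⟨fun j k h => hd_inj (u.injective ?_), fun b => ?_⟩
    · rw [← hpos j, ← hpos k]
      exact congrArg (· + 1) h
    · have hne : u.symm (b + 1) ≠ i := by simp [hi]
      refine ⟨if u.symm (b + 1) < i then u.symm (b + 1) else u.symm (b + 1) - 1, ?_⟩
      have : d (if u.symm (b + 1) < i then u.symm (b + 1) else u.symm (b + 1) - 1) =
          u.symm (b + 1) := by
        simp only [d]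
        split_ifs <;> omega
      simp only [this, Equiv.apply_symm_apply, Nat.add_sub_cancel]
  refine ⟨Equiv.ofBijective _ hbij, Equiv.ext fun j => ?_⟩
  rw [ins_apply, Equiv.ofBijective_apply, Equiv.ofBijective_apply, hpos, hpos]
  simp only [d]
  split_ifs with h1 h2 h3
  · rfl
  · rw [h2, hui]
  · omega
  · rw [Nat.sub_add_cancel (by omega)]

theorem exists_ins_of_inSn {n : ℕ} {u : Equiv.Perm ℕ} (hu : inSn (n + 1) u) :
    ∃ i w, i ≤ n ∧ inSn n w ∧ ins i w = u := by
  obtain ⟨w, hw⟩ := exists_ins_eq u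
  have hi : u.symm 0 ≤ n := by
    by_contra! h
    have := hu _ h
    rw [Equiv.apply_symm_apply] at this
    omega
  refine ⟨_, w, hi, fun j hj => ?_, hw⟩
  have := hu (j + 1) (by omega)
  rw [← hw, ins_apply, if_neg (by omega), if_neg (by omega)] at this
  simpa using this

theorem uv_append_singleton (L : List RTLetter) (X : RTLetter) :
    uv (L ++ [X]) = stepRT (uv L) X := by
  simp [uv]

theorem stepRT_inj {p q : Equiv.Perm ℕ × Equiv.Perm ℕ} {X Y : RTLetter} :
    stepRT p X = stepRT q Y ↔ p = q ∧ X = Y := by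
  obtain ⟨p₁, p₂⟩ := p
  obtain ⟨q₁, q₂⟩ := q
  cases X <;> cases Y <;> simp only [stepRT, Prod.mk.injEq, ins_inj, RTLetter.r.injEq,
    RTLetter.t.injEq, reduceCtorEq] <;> grind

theorem uv_injOn_length (n : ℕ) : Set.InjOn uv {L | L.length = n} := by
  induction n with
  | zero =>
    intro L hL M hM _
    rw [List.length_eq_zero_iff.1 hL, List.length_eq_zero_iff.1 hM]
  | succ n ih =>
    intro L hL M hM h
    obtain rfl | ⟨L, X, rfl⟩ := L.eq_nil_or_concat'
    · simp at hL
    obtain rfl | ⟨M, Y, rfl⟩ := M.eq_nil_or_concat'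
    · simp at hM
    rw [uv_append_singleton, uv_append_singleton, stepRT_inj] at h
    rw [ih (by simpa using hL) (by simpa using hM) h.1, h.2]

theorem validSeq_append_singleton {n : ℕ} {L : List RTLetter} {X : RTLetter} :
    validSeq (n + 1) (L ++ [X]) ↔ validSeq n L ∧ validLetter n X := by
  simp only [validSeq, List.length_append, List.length_singleton, Nat.add_right_cancel_iff,
    Nat.lt_succ_iff_lt_or_eq, or_imp, forall_and, forall_eq]
  constructor
  · rintro ⟨rfl, h, h'⟩
    refine ⟨⟨rfl, fun p hp => ?_⟩, by simpa using h'⟩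
    simpa [List.getElem?_append_left hp] using h p hp
  · rintro ⟨⟨rfl, h⟩, h'⟩
    refine ⟨rfl, fun p hp => ?_, by simpa using h'⟩
    simpa [List.getElem?_append_left hp] using h p hp

theorem uv_mem_of_validSeq {n : ℕ} {L : List RTLetter} (hL : validSeq n L) :
    inSn n (uv L).1 ∧ inSn n (uv L).2 ∧
      ∀ a < n, lA a (uv L).2 = lA a (uv L).1 ∨ lA a (uv L).2 = lA a (uv L).1 + 1 := by
  induction n generalizing L with
  | zero =>
    rw [List.length_eq_zero_iff.1 hL.1]
    exact ⟨fun _ _ => rfl, fun _ _ => rfl, fun a ha => absurd ha a.not_lt_zero⟩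
  | succ n ih =>
    obtain rfl | ⟨L, X, rfl⟩ := L.eq_nil_or_concat'
    · simp [validSeq] at hL
    obtain ⟨hL, hX⟩ := validSeq_append_singleton.1 hL
    obtain ⟨hu, hv, hl⟩ := ih hL
    rw [uv_append_singleton]
    cases X with
    | r k =>
      refine ⟨inSn_ins hX hu, inSn_ins hX hv, fun a ha => ?_⟩
      cases a with
      | zero => simp [stepRT, lA_zero, ins_symm_zero]
      | succ a => simpa only [stepRT, lA_succ_ins] using hl a (by omega)
    | t k =>
      refine ⟨inSn_ins (Nat.le_of_succ_le hX) hu, inSn_ins hX hv, fun a ha => ?_⟩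
      cases a with
      | zero => simp [stepRT, lA_zero, ins_symm_zero]
      | succ a => simpa only [stepRT, lA_succ_ins] using hl a (by omega)

theorem exists_validSeq_uv_eq {n : ℕ} {u v : Equiv.Perm ℕ} (hu : inSn n u) (hv : inSn n v)
    (h : ∀ a < n, lA a v = lA a u ∨ lA a v = lA a u + 1) :
    ∃ L, validSeq n L ∧ uv L = (u, v) := by
  induction n generalizing u v with
  | zero =>
    refine ⟨[], by simp [validSeq], ?_⟩
    rw [show u = 1 from Equiv.ext fun j => hu j j.zero_le,
      show v = 1 from Equiv.ext fun j => hv j j.zero_le]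
    rfl
  | succ n ih =>
    obtain ⟨i, u, hi, hu', rfl⟩ := exists_ins_of_inSn hu
    obtain ⟨j, v, hj, hv', rfl⟩ := exists_ins_of_inSn hv
    obtain ⟨L, hL, huv⟩ := ih hu' hv' fun a ha => by
      simpa only [lA_succ_ins] using h (a + 1) (by omega)
    have h0 := h 0 n.succ_pos
    simp only [lA_zero, ins_symm_zero, Nat.add_right_cancel_iff] at h0
    obtain rfl | rfl := h0
    · exact ⟨L ++ [.r j], (validSeq_append_singleton (X := .r j)).2 ⟨hL, hj⟩, by
        rw [uv_append_singleton, huv, stepRT]⟩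
    · exact ⟨L ++ [.t i], (validSeq_append_singleton (X := .t i)).2 ⟨hL, hj⟩, by
        rw [uv_append_singleton, huv, stepRT]⟩

theorem stmt11 (n : ℕ) (hn : 1 ≤ n) :
    Set.InjOn uv {L : List RTLetter | validSeq n L} ∧
    uv '' {L : List RTLetter | validSeq n L} =
      {p : Equiv.Perm ℕ × Equiv.Perm ℕ |
        inSn n p.1 ∧ inSn n p.2 ∧
        ∀ a < n, lA a p.2 = lA a p.1 ∨ lA a p.2 = lA a p.1 + 1} := by
  refine ⟨(uv_injOn_length n).mono fun L hL => hL.1, Set.Subset.antisymm ?_ ?_⟩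
  · rintro _ ⟨L, hL, rfl⟩
    exact uv_mem_of_validSeq hL
  · rintro ⟨u, v⟩ ⟨hu, hv, h⟩
    exact exists_validSeq_uv_eq hu hv h
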